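/- Let $T_{q_0}$ be an initial one-way synchronizing transducer representing a homeomorphism of $\mathfrak{C}_n$. Then the conjugates of $V_n$ by powers of $T_{q_0}$ form a strictly increasing chain: for every integer $m$, $V_n^{T_{q_0}^{m+1}} \subsetneq V_n^{T_{q_0}^{m}}$; in particular $\dots \subsetneq V_n^{T_{q_0}^{2}} \subsetneq V_n^{T_{q_0}} \subsetneq V_n \subsetneq V_n^{T_{q_0}^{-1}} \subsetneq V_n^{T_{q_0}^{-2}} \subsetneq \dots$, where $V_n^{h} = h^{-1} V_n h$. -/

import Mathlib

open Classical

noncomputable section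

/-- `n`-ary Cantor space: infinite words over the alphabet `Fin n`. -/
abbrev Cantor (n : ℕ) : Type := ℕ → Fin n

/-- The finite word `w` is a prefix of the infinite word `χ`. -/
def PrefixOf {n : ℕ} (w : List (Fin n)) (χ : Cantor n) : Prop :=
  ∀ (i : ℕ) (h : i < w.length), w.get ⟨i, h⟩ = χ i

/-- Concatenation of a finite word with an infinite word. -/
def appendInf {n : ℕ} (w : List (Fin n)) (χ : Cantor n) : Cantor n :=
  fun i => if h : i < w.length then w.get ⟨i, h⟩ else χ (i - w.length)

/-- The cone (basic clopen set) of infinite words having the finite word `w` as prefix. -/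
def cone {n : ℕ} (w : List (Fin n)) : Set (Cantor n) :=
  {χ | PrefixOf w χ}

/-- The length-`k` prefix of an infinite word, as a finite word. -/
def takeW {n : ℕ} (χ : Cantor n) (k : ℕ) : List (Fin n) :=
  List.ofFn (fun i : Fin k => χ i)

/-- A finite family of finite words forming a maximal antichain:
every infinite word has exactly one member of the family as a prefix. -/
def AntichainFam {n m : ℕ} (α : Fin m → List (Fin n)) : Prop :=
  ∀ χ : Cantor n, ∃! i : Fin m, PrefixOf (α i) χ

/-- The group structure on self-homeomorphisms of a topological space,
with `f * g` acting as `g` followed by `f`. -/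
instance homeoGroup {X : Type*} [TopologicalSpace X] : Group (X ≃ₜ X) where
  mul f g := g.trans f
  one := Homeomorph.refl X
  inv := Homeomorph.symm
  mul_assoc a b c := Homeomorph.ext fun _ => rfl
  one_mul a := Homeomorph.ext fun _ => rfl
  mul_one a := Homeomorph.ext fun _ => rfl
  inv_mul_cancel a := Homeomorph.ext fun x => a.symm_apply_apply x

/-- The Higman–Thompson group `Vₙ`, as the set of self-homeomorphisms of Cantor space
which act by exchanging finite prefixes along a pair of maximal antichains. -/
def Vn (n : ℕ) : Set (Cantor n ≃ₜ Cantor n) :=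
  {g | ∃ (m : ℕ) (α β : Fin m → List (Fin n)), AntichainFam α ∧ AntichainFam β ∧
      ∀ (i : Fin m) (χ : Cantor n), g (appendInf (α i) χ) = appendInf (β i) χ}

/-- Conjugation in the paper's right-action convention: `paperConj g v = g⁻¹ v g`,
i.e. the homeomorphism `x ↦ (x) g⁻¹ v g` (first apply `g⁻¹`, then `v`, then `g`). -/
def paperConj {n : ℕ} (g v : Cantor n ≃ₜ Cantor n) : Cantor n ≃ₜ Cantor n :=
  (g.symm.trans v).trans g

/-- `l` is the longest common prefix of the set `A` of infinite words. -/
def IsLCP {n : ℕ} (A : Set (Cantor n)) (l : List (Fin n)) : Prop :=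
  (∀ ρ ∈ A, PrefixOf l ρ) ∧
    ∀ l' : List (Fin n), (∀ ρ ∈ A, PrefixOf l' ρ) → l'.length ≤ l.length

/-- A (not necessarily finite-state) transducer over the alphabet `Fin n`. -/
structure Transducer (n : ℕ) where
  /-- the set of states -/
  Q : Type
  /-- the transition function -/
  tr : Fin n → Q → Q
  /-- the output (rewrite) function -/
  out : Fin n → Q → List (Fin n)

namespace Transducer

variable {n : ℕ}

/-- The transition function extended to finite words. -/
def transStar (T : Transducer n) : List (Fin n) → T.Q → T.Q
  | [], q => q
  | x :: w, q => T.transStar w (T.tr x q)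

/-- The output function extended to finite words. -/
def outStar (T : Transducer n) : List (Fin n) → T.Q → List (Fin n)
  | [], _ => []
  | x :: w, q => T.out x q ++ T.outStar w (T.tr x q)

/-- The initial transducer `T_q` induces the map `f` on Cantor space: the outputs along
ever longer prefixes of `χ` are ever longer prefixes of `f χ`. -/
def Induces (T : Transducer n) (q : T.Q) (f : Cantor n → Cantor n) : Prop :=
  ∀ (χ : Cantor n) (m : ℕ), ∃ k : ℕ,
    m ≤ (T.outStar (takeW χ k) q).length ∧ PrefixOf (T.outStar (takeW χ k) q) (f χ)

/-- The image of the state `q`: the image of Cantor space under the map induced by `T_q`. -/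
def stateImage (T : Transducer n) (q : T.Q) : Set (Cantor n) :=
  {y | ∃ (f : Cantor n → Cantor n) (χ : Cantor n), T.Induces q f ∧ f χ = y}

/-- `T` is synchronizing at level `k`: the state reached after reading any word of
length `k` does not depend on the starting state. -/
def SyncAtLevel (T : Transducer n) (k : ℕ) : Prop :=
  ∀ w : List (Fin n), w.length = k → ∀ q q' : T.Q, T.transStar w q = T.transStar w q'

/-- `T` is synchronizing if it is synchronizing at some level. -/
def Synchronizing (T : Transducer n) : Prop := ∃ k, T.SyncAtLevel k

/-- `T` (inducing the homeomorphism `h` at `q0`) is one-way synchronizing: `T` is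
synchronizing, but the inverse homeomorphism is not induced by any finite
synchronizing transducer (equivalently, the inverse transducer is not synchronizing). -/
def OneWaySync (T : Transducer n) (q0 : T.Q) (h : Cantor n ≃ₜ Cantor n) : Prop :=
  T.Induces q0 ⇑h ∧ T.Synchronizing ∧
    ¬ ∃ (S : Transducer n) (_ : Finite S.Q) (s0 : S.Q),
        S.Induces s0 ⇑h.symm ∧ S.Synchronizing

/-- `T` is equal to its core : every state is reached by reading a word of length `k`
from some state, for every synchronizing level `k`. -/
def EqualToCore (T : Transducer n) : Prop :=
  ∀ k : ℕ, T.SyncAtLevel k → ∀ q : T.Q, ∃ (w : List (Fin n)) (p : T.Q),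
    w.length = k ∧ T.transStar w p = q

/-- Every state of `T` is accessible from `q0`. -/
def Accessible (T : Transducer n) (q0 : T.Q) : Prop :=
  ∀ q : T.Q, ∃ w : List (Fin n), T.transStar w q0 = q

/-- The product transducer `T S` (first act by `T`, then by `S`). -/
def prod (T S : Transducer n) : Transducer n where
  Q := T.Q × S.Q
  tr := fun x p => (T.tr x p.1, S.transStar (T.out x p.1) p.2)
  out := fun x p => S.outStar (T.out x p.1) p.2

/-- `T` is partially invertible: every state induces an injective map on Cantor space
with clopen image. -/
def PartiallyInvertible (T : Transducer n) : Prop :=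
  ∀ q : T.Q, ∃ f : Cantor n → Cantor n,
    T.Induces q f ∧ Function.Injective f ∧ IsClopen (Set.range f)

/-- `T` has no states of incomplete response: for each state `q` and letter `i`, no word
strictly longer than `λ(i,q)` is a common prefix of the outputs on all of the cone `[i]`. -/
def NoIncompleteResponse (T : Transducer n) : Prop :=
  ∀ (q : T.Q) (i x : Fin n),
    ¬ ∀ χ : Cantor n, ∃ k : ℕ, (T.out i q ++ [x]) <+: T.outStar (i :: takeW χ k) q

/-- States `q` of `T` and `p` of `S` are `ω`-equivalent: they induce one and the same
map on Cantor space. -/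
def OmegaEq (T : Transducer n) (q : T.Q) (S : Transducer n) (p : S.Q) : Prop :=
  ∃ f : Cantor n → Cantor n, T.Induces q f ∧ S.Induces p f

/-- `T` is minimal: no states of incomplete response and no pair of distinct
`ω`-equivalent states. -/
def Minimal (T : Transducer n) : Prop :=
  T.NoIncompleteResponse ∧ ∀ q q' : T.Q, T.OmegaEq q T q' → q = q'

/-- The map on Cantor space induced by the state `q` (junk value if none exists). -/
def inducedMap (T : Transducer n) (q : T.Q) : Cantor n → Cantor n :=
  if h : ∃ f, T.Induces q f then h.choose else id

/-- `𝓛_q(α)`: the longest common prefix of the preimage of the cone `[α]` under `T_q`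
(junk value if it does not exist). -/
def lcp (T : Transducer n) (q : T.Q) (α : List (Fin n)) : List (Fin n) :=
  if h : ∃ l, IsLCP {ρ : Cantor n | T.inducedMap q ρ ∈ cone α} l then h.choose else []

/-- The inverse transducer of `T` given by the inversion algorithm, on the set of all
pairs `(w, q)`: reading `x` from `(w,q)` outputs `𝓛_q(wx)` and moves to
`(wx - λ(𝓛_q(wx), q), π(𝓛_q(wx), q))`. -/
def invT (T : Transducer n) : Transducer n where
  Q := List (Fin n) × T.Q
  tr := fun x p =>
    ((p.1 ++ [x]).drop (T.outStar (T.lcp p.2 (p.1 ++ [x])) p.2).length,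
      T.transStar (T.lcp p.2 (p.1 ++ [x])) p.2)
  out := fun x p => T.lcp p.2 (p.1 ++ [x])

/-- Restriction of a transducer to a set of states (transitions leaving the set are
replaced by junk loops; for transition-closed sets this is the honest restriction). -/
def restrictTo (T : Transducer n) (P : T.Q → Prop) : Transducer n where
  Q := {q : T.Q // P q}
  tr := fun x q => if h : P (T.tr x q.1) then ⟨T.tr x q.1, h⟩ else q
  out := fun x q => T.out x q.1

/-- The set of states reachable from `q0`. -/
def reach (T : Transducer n) (q0 : T.Q) : T.Q → Prop :=
  fun q => ∃ w : List (Fin n), T.transStar w q0 = q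

/-- The inverse transducer of the initial transducer `T_{q0}`, with state set the states
accessible from `(ε, q0)`. -/
def invAcc (T : Transducer n) (q0 : T.Q) : Transducer n :=
  (T.invT).restrictTo ((T.invT).reach ([], q0))

/-- A pair `(w,p)` is good if `[w] ⊆ im(T_p)` and `𝓛_p(w) = ε`. -/
def GoodPair (T : Transducer n) (p : List (Fin n) × T.Q) : Prop :=
  cone p.1 ⊆ T.stateImage p.2 ∧
    IsLCP {ρ : Cantor n | T.inducedMap p.2 ρ ∈ cone p.1} []

/-- The partial inverse `T'` of a partially invertible transducer `T`: the inverse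
transducer restricted to the good pairs `(w,p)` with `[w] ⊆ im(T_p)`, `𝓛_p(w) = ε`. -/
def partialInv (T : Transducer n) : Transducer n :=
  (T.invT).restrictTo T.GoodPair

/-- `h` is a completion of `T`: there are a maximal antichain `η` and an effective viable
combination `(ρ, p)` such that `h` maps `η_i χ` to `ρ_i (χ)T_{p_i}`. -/
def IsCompletion (T : Transducer n) (h : Cantor n ≃ₜ Cantor n) : Prop :=
  ∃ (l : ℕ) (η ρ : Fin l → List (Fin n)) (p : Fin l → T.Q)
      (f : Fin l → (Cantor n → Cantor n)),
    l % (n - 1) = 1 % (n - 1) ∧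
    AntichainFam η ∧
    (∀ i, T.Induces (p i) (f i)) ∧
    (⋃ i, appendInf (ρ i) '' Set.range (f i)) = Set.univ ∧
    (∀ i j, i ≠ j →
      Disjoint (appendInf (ρ i) '' Set.range (f i))
        (appendInf (ρ j) '' Set.range (f j))) ∧
    ∀ (i : Fin l) (χ : Cantor n), h (appendInf (η i) χ) = appendInf (ρ i) (f i χ)

/-- The group `𝓗(T)` generated by all completions of `T`. -/
def HGroup (T : Transducer n) : Subgroup (Cantor n ≃ₜ Cantor n) :=
  Subgroup.closure {h | T.IsCompletion h}

/-- The subgroup-generating equivalence relation induced by the automaton underlying a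
transducer `A` with start state `a0` (by Lemma 4.1, two words are related iff the states
they reach are identified by the collapsing procedure, i.e. iff the reached states
transition identically on all sufficiently long words). -/
def simA (A : Transducer n) (a0 : A.Q) (α β : List (Fin n)) : Prop :=
  ∃ i : ℕ, ∀ w : List (Fin n), w.length = i →
    A.transStar w (A.transStar α a0) = A.transStar w (A.transStar β a0)

/-- `if b then T else T'`. -/
def factor (T : Transducer n) (b : Bool) : Transducer n :=
  if b then T else T.partialInv

/-- The product of a nonempty list of factors, each equal to `T` or its partial
inverse `T'`; these products make up the set `Π(T)`. -/
def prodOf (T : Transducer n) : List Bool → Transducer n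
  | [] => T
  | [b] => T.factor b
  | b :: c :: rest => (T.factor b).prod (T.prodOf (c :: rest))

/-- `T` is contracting: every state of every product of copies of `T` and `T'` is
`ω`-equivalent to an initial transducer which, after reading some fixed length of input,
always acts as a state of `T`. -/
def Contracting (T : Transducer n) : Prop :=
  ∀ L : List Bool, L ≠ [] → ∀ q : (T.prodOf L).Q,
    ∃ (V : Transducer n) (p : V.Q) (f : Cantor n → Cantor n),
      (T.prodOf L).Induces q f ∧ V.Induces p f ∧
      ∃ j : ℕ, ∀ w : List (Fin n), w.length = j →
        ∃ (u : T.Q) (g : Cantor n → Cantor n),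
          V.Induces (V.transStar w p) g ∧ T.Induces u g

end Transducer

/-- The element `v` of `Vₙ` preserves the relation `r` on nonempty finite words:
whenever `v` replaces the prefix `α` by `β`, the words `α` and `β` are related. -/
def PreservesRel {n : ℕ} (r : List (Fin n) → List (Fin n) → Prop)
    (g : Cantor n ≃ₜ Cantor n) : Prop :=
  ∀ (α β : List (Fin n)), α ≠ [] → β ≠ [] →
    (∀ χ : Cantor n, g (appendInf α χ) = appendInf β χ) → r α β

/-- The subgroup `V_∼` of `Vₙ` generated by the prefix-exchange homeomorphisms
preserving the relation `r`. -/
def VSim (n : ℕ) (r : List (Fin n) → List (Fin n) → Prop) :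
    Subgroup (Cantor n ≃ₜ Cantor n) :=
  Subgroup.closure {g | g ∈ Vn n ∧ PreservesRel r g}

/-- `f` coincides with `g` on the cone `[α]` (conjugated into the cone) and is the
identity off the cone: the homeomorphism `[α]_g`. -/
def IsRestrTo {n : ℕ} (α : List (Fin n)) (g f : Cantor n ≃ₜ Cantor n) : Prop :=
  (∀ χ : Cantor n, f (appendInf α χ) = appendInf α (g χ)) ∧
  ∀ χ : Cantor n, ¬ PrefixOf α χ → f χ = χ

/-- The Nekrashevych group `Vₙ(G)`: the group generated by `Vₙ` together with all the
homeomorphisms `[α]_g` for `g ∈ G`. -/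
def NekG (n : ℕ) (G : Subgroup (Cantor n ≃ₜ Cantor n)) :
    Subgroup (Cantor n ≃ₜ Cantor n) :=
  Subgroup.closure (Vn n ∪ {f | ∃ (α : List (Fin n)) (g : Cantor n ≃ₜ Cantor n),
    g ∈ G ∧ IsRestrTo α g f})

/-- The homeomorphism `f` locally agrees with the set `G` of homeomorphisms. -/
def LocallyAgrees {n : ℕ} (G : Set (Cantor n ≃ₜ Cantor n))
    (f : Cantor n ≃ₜ Cantor n) : Prop :=
  ∀ x : Cantor n, ∃ U : Set (Cantor n), IsOpen U ∧ x ∈ U ∧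
    ∃ g ∈ G, Set.EqOn ⇑f ⇑g U

/-- A finite synchronous invertible transducer over `Fin n`: each state rewrites single
letters to single letters bijectively. -/
structure SyncTransducer (n : ℕ) where
  /-- the set of states -/
  Q : Type
  /-- there are finitely many states -/
  fin : Finite Q
  /-- the transition function -/
  tr : Fin n → Q → Q
  /-- the (single-letter) output function -/
  out : Fin n → Q → Fin n
  /-- each state rewrites letters bijectively -/
  bij : ∀ q : Q, Function.Bijective fun x => out x q

namespace SyncTransducer

variable {n : ℕ}

/-- The transition function extended to finite words. -/
def trStar (U : SyncTransducer n) : List (Fin n) → U.Q → U.Q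
  | [], q => q
  | x :: w, q => U.trStar w (U.tr x q)

/-- The output function extended to finite words. -/
def outWord (U : SyncTransducer n) : List (Fin n) → U.Q → List (Fin n)
  | [], _ => []
  | x :: w, q => U.out x q :: U.outWord w (U.tr x q)

/-- The map on Cantor space induced by the initial transducer `U_q`. -/
def applyFun (U : SyncTransducer n) (q : U.Q) (χ : Cantor n) : Cantor n :=
  fun i => U.out (χ i) (U.trStar (takeW χ i) q)

/-- The inverse transducer of a synchronous invertible transducer. -/
def inv (U : SyncTransducer n) : SyncTransducer n where
  Q := U.Q
  fin := U.fin
  tr := fun y q => U.tr ((Equiv.ofBijective _ (U.bij q)).symm y) q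
  out := fun y q => (Equiv.ofBijective _ (U.bij q)).symm y
  bij := fun q => (Equiv.ofBijective _ (U.bij q)).symm.bijective

/-- The product of synchronous transducers (first act by `T`, then by `S`). -/
def sprod (T S : SyncTransducer n) : SyncTransducer n where
  Q := T.Q × S.Q
  fin := by
    haveI := T.fin; haveI := S.fin
    infer_instance
  tr := fun x p => (T.tr x p.1, S.tr (T.out x p.1) p.2)
  out := fun x p => S.out (T.out x p.1) p.2
  bij := fun p => (S.bij p.2).comp (T.bij p.1)

/-- `U` is synchronizing at level `k`. -/
def SyncAtLevel (U : SyncTransducer n) (k : ℕ) : Prop :=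
  ∀ w : List (Fin n), w.length = k → ∀ q q' : U.Q, U.trStar w q = U.trStar w q'

/-- `U` is synchronizing. -/
def Synchronizing (U : SyncTransducer n) : Prop := ∃ k, U.SyncAtLevel k

/-- `U` is minimal (under `ω`-equivalence): distinct states induce distinct maps. -/
def Minimal (U : SyncTransducer n) : Prop :=
  ∀ q q' : U.Q, U.applyFun q = U.applyFun q' → q = q'

/-- One-way synchronizing: `U` is synchronizing but the inverse homeomorphism of
`h = U_{q0}` is not induced by any finite synchronizing transducer. -/
def OneWaySync (U : SyncTransducer n) (h : Cantor n ≃ₜ Cantor n) : Prop :=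
  U.Synchronizing ∧
    ¬ ∃ (S : Transducer n) (_ : Finite S.Q) (s0 : S.Q),
        S.Induces s0 ⇑h.symm ∧ S.Synchronizing

/-- `U` is equal to its core. -/
def EqualToCore (U : SyncTransducer n) : Prop :=
  ∀ k : ℕ, U.SyncAtLevel k → ∀ q : U.Q, ∃ (w : List (Fin n)) (p : U.Q),
    w.length = k ∧ U.trStar w p = q

/-- The underlying (asynchronous-format) transducer of a synchronous transducer. -/
def toT (U : SyncTransducer n) : Transducer n :=
  ⟨U.Q, U.tr, fun x q => [U.out x q]⟩

/-- The automaton group `𝒢(U)` generated by `U`: the subgroup of the homeomorphism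
group of Cantor space generated by the homeomorphisms `U_q` for the states `q`. -/
def autG (U : SyncTransducer n) : Subgroup (Cantor n ≃ₜ Cantor n) :=
  Subgroup.closure {f : Cantor n ≃ₜ Cantor n | ∃ q : U.Q, ⇑f = U.applyFun q}

end SyncTransducer

section WordCalculus

variable {n : ℕ}

/-- The infinite word obtained by deleting the first `k` letters. -/
def dropInf (k : ℕ) (χ : Cantor n) : Cantor n := fun i => χ (i + k)

theorem appendInf_of_lt {w : List (Fin n)} {χ : Cantor n} {i : ℕ} (h : i < w.length) :
    appendInf w χ i = w[i] := by
  simp [appendInf, h]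

theorem appendInf_add_length (w : List (Fin n)) (χ : Cantor n) (i : ℕ) :
    appendInf w χ (i + w.length) = χ i := by
  simp [appendInf]

theorem appendInf_append (u v : List (Fin n)) (χ : Cantor n) :
    appendInf (u ++ v) χ = appendInf u (appendInf v χ) := by
  funext i
  simp only [appendInf, List.length_append, List.get_eq_getElem, List.getElem_append]
  split_ifs <;> first | rfl | omega | (congr 1; omega)

@[simp] theorem appendInf_nil (χ : Cantor n) : appendInf [] χ = χ := by
  funext i; simp [appendInf]

@[simp] theorem dropInf_appendInf (w : List (Fin n)) (χ : Cantor n) :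
    dropInf w.length (appendInf w χ) = χ :=
  funext fun i => appendInf_add_length w χ i

theorem appendInf_injective (w : List (Fin n)) : Function.Injective (appendInf w) :=
  fun x y hxy => by simpa using congrArg (dropInf w.length) hxy

@[simp] theorem length_takeW (χ : Cantor n) (k : ℕ) : (takeW χ k).length = k := by
  simp [takeW]

theorem getElem_takeW (χ : Cantor n) (k i : ℕ) (h : i < (takeW χ k).length) :
    (takeW χ k)[i] = χ i := by
  simp [takeW]

@[simp] theorem appendInf_takeW (χ : Cantor n) (k : ℕ) :
    appendInf (takeW χ k) (dropInf k χ) = χ := by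
  funext i
  by_cases h : i < k
  · rw [appendInf_of_lt (by simpa using h), getElem_takeW]
  · simp [appendInf, h, dropInf, Nat.sub_add_cancel (not_lt.mp h)]

theorem takeW_eq_takeW_iff {x y : Cantor n} {k : ℕ} :
    takeW x k = takeW y k ↔ ∀ i < k, x i = y i := by
  rw [takeW, takeW, List.ofFn_inj, funext_iff]
  exact ⟨fun h i hi => h ⟨i, hi⟩, fun h i => h i i.2⟩

theorem prefixOf_iff_takeW {w : List (Fin n)} {χ : Cantor n} :
    PrefixOf w χ ↔ takeW χ w.length = w := by
  constructor
  · intro h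
    refine List.ext_getElem (by simp) fun i h₁ h₂ => ?_
    rw [getElem_takeW]
    exact (h i h₂).symm
  · intro h i hi
    have : χ i = w[i] := by
      rw [← getElem_takeW χ w.length i (by simpa using hi)]
      simp only [h]
    simpa using this.symm

@[simp] theorem prefixOf_appendInf (w : List (Fin n)) (χ : Cantor n) :
    PrefixOf w (appendInf w χ) := fun i h => by
  rw [appendInf_of_lt h, List.get_eq_getElem]

@[simp] theorem takeW_appendInf (w : List (Fin n)) (χ : Cantor n) :
    takeW (appendInf w χ) w.length = w :=
  prefixOf_iff_takeW.mp (prefixOf_appendInf w χ)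

theorem PrefixOf.appendInf_dropInf {w : List (Fin n)} {χ : Cantor n} (h : PrefixOf w χ) :
    appendInf w (dropInf w.length χ) = χ := by
  conv_lhs => rw [← prefixOf_iff_takeW.mp h, length_takeW]
  exact appendInf_takeW χ _

theorem takeW_add (χ : Cantor n) (k l : ℕ) :
    takeW χ (k + l) = takeW χ k ++ takeW (dropInf k χ) l := by
  refine List.ext_getElem (by simp) fun i h₁ h₂ => ?_
  rw [getElem_takeW, List.getElem_append]
  split_ifs with h
  · rw [getElem_takeW]
  · rw [getElem_takeW, dropInf, length_takeW]
    rw [length_takeW] at h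
    congr 1
    omega

theorem takeW_appendInf_add (w : List (Fin n)) (χ : Cantor n) (l : ℕ) :
    takeW (appendInf w χ) (w.length + l) = w ++ takeW χ l := by
  rw [takeW_add, takeW_appendInf, dropInf_appendInf]

theorem takeW_prefix_of_le {χ : Cantor n} {k l : ℕ} (h : k ≤ l) :
    takeW χ k <+: takeW χ l := by
  obtain ⟨d, rfl⟩ := Nat.exists_eq_add_of_le h
  rw [takeW_add]
  exact List.prefix_append _ _

theorem PrefixOf.of_isPrefix {u v : List (Fin n)} {χ : Cantor n} (h : u <+: v)
    (hv : PrefixOf v χ) : PrefixOf u χ := by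
  obtain ⟨t, rfl⟩ := h
  rw [← hv.appendInf_dropInf, appendInf_append]
  exact prefixOf_appendInf _ _

theorem PrefixOf.isPrefix {u v : List (Fin n)} {χ : Cantor n} (hu : PrefixOf u χ)
    (hv : PrefixOf v χ) (h : u.length ≤ v.length) : u <+: v := by
  rw [← prefixOf_iff_takeW.mp hu, ← prefixOf_iff_takeW.mp hv]
  exact takeW_prefix_of_le h

theorem isOpen_setOf_takeW_eq (x : Cantor n) (k : ℕ) :
    IsOpen {y : Cantor n | takeW y k = takeW x k} := by
  have : {y : Cantor n | takeW y k = takeW x k} = PiNat.cylinder x k := by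
    ext y
    exact takeW_eq_takeW_iff
  rw [this]
  exact PiNat.isOpen_cylinder _ x k

theorem IsOpen.exists_takeW {U : Set (Cantor n)} (hU : IsOpen U) {x : Cantor n} (hx : x ∈ U) :
    ∃ k, ∀ y, takeW y k = takeW x k → y ∈ U := by
  obtain ⟨_, ⟨z, k, rfl⟩, hxz, hsub⟩ :=
    (PiNat.isTopologicalBasis_cylinders (fun _ : ℕ => Fin n)).exists_subset_of_mem_open hx hU
  refine ⟨k, fun y hy => hsub fun i hi => ?_⟩
  rw [takeW_eq_takeW_iff.mp hy i hi]
  exact hxz i hi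

theorem Continuous.exists_takeW {f : Cantor n → Cantor n} (hf : Continuous f)
    (x : Cantor n) (m : ℕ) :
    ∃ k, ∀ y, takeW y k = takeW x k → takeW (f y) m = takeW (f x) m :=
  IsOpen.exists_takeW ((isOpen_setOf_takeW_eq (f x) m).preimage hf) rfl

/-- A property of finite words that holds for all words extending some prefix of each infinite
word holds for all sufficiently long words. -/
theorem exists_forall_length_ge [Nonempty (Fin n)] {E : List (Fin n) → Prop}
    (hE : ∀ χ : Cantor n, ∃ j, ∀ u, takeW χ j <+: u → E u) :
    ∃ k, ∀ u : List (Fin n), k ≤ u.length → E u := by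
  choose j hj using hE
  obtain ⟨t, ht⟩ := isCompact_univ.elim_finite_subcover
    (fun χ : Cantor n => {y : Cantor n | takeW y (j χ) = takeW χ (j χ)})
    (fun χ => isOpen_setOf_takeW_eq χ _) fun χ _ => Set.mem_iUnion.mpr ⟨χ, rfl⟩
  refine ⟨t.sup j, fun u hu => ?_⟩
  obtain ⟨a⟩ := ‹Nonempty (Fin n)›
  have hmem := ht (Set.mem_univ (appendInf u fun _ => a))
  simp only [Set.mem_iUnion, Set.mem_ofPred_eq, exists_prop] at hmem
  obtain ⟨χ, hχ, h⟩ := hmem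
  refine hj χ u ?_
  rw [← h]
  conv_rhs => rw [← takeW_appendInf u fun _ => a]
  exact takeW_prefix_of_le ((Finset.le_sup hχ).trans hu)

theorem incomparable_of_ne {x y : Fin n} (hxy : x ≠ y) (u v : List (Fin n)) (χ : Cantor n)
    (hx : PrefixOf (x :: u) χ) : ¬ PrefixOf (y :: v) χ := fun hy =>
  hxy ((hx 0 (by simp)).trans (hy 0 (by simp)).symm)

end WordCalculus

section LocalPrefixExchange

variable {n : ℕ}

/-- Near every point, `f` replaces a prefix by another word. -/
def LocallyExchangesPrefixes (f : Cantor n → Cantor n) : Prop :=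
  ∀ x : Cantor n, ∃ (k : ℕ) (β : List (Fin n)),
    ∀ χ, f (appendInf (takeW x k) χ) = appendInf β χ

theorem locallyExchangesPrefixes_of_mem_Vn {g : Cantor n ≃ₜ Cantor n} (hg : g ∈ Vn n) :
    LocallyExchangesPrefixes g := by
  obtain ⟨m, α, β, hα, -, hαβ⟩ := hg
  intro x
  obtain ⟨i, hi, -⟩ := hα x
  refine ⟨(α i).length, β i, fun χ => ?_⟩
  rw [prefixOf_iff_takeW.mp hi, hαβ]

theorem mem_Vn_of_locallyExchangesPrefixes [Nonempty (Fin n)] {g : Cantor n ≃ₜ Cantor n}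
    (hg : LocallyExchangesPrefixes g) : g ∈ Vn n := by
  obtain ⟨k, hk⟩ := exists_forall_length_ge
    (E := fun u : List (Fin n) => ∃ β, ∀ χ, g (appendInf u χ) = appendInf β χ) (by
      intro x
      obtain ⟨j, β, hβ⟩ := hg x
      refine ⟨j, ?_⟩
      rintro _ ⟨t, rfl⟩
      exact ⟨β ++ t, fun χ => by rw [appendInf_append, hβ, appendInf_append]⟩)
  let e := (Fintype.equivFin (Fin k → Fin n)).symm
  have hlen (i) : (List.ofFn (e i)).length = k := List.length_ofFn
  choose β hβ using fun i => hk (List.ofFn (e i)) (hlen i).ge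
  have hα : AntichainFam fun i => List.ofFn (e i) := by
    intro χ
    refine ⟨e.symm fun i => χ i, ?_, fun i hi => ?_⟩
    · beta_reduce
      rw [prefixOf_iff_takeW, hlen, e.apply_symm_apply, takeW]
    · rw [Equiv.eq_symm_apply]
      have := prefixOf_iff_takeW.mp hi
      rw [hlen, takeW, List.ofFn_inj] at this
      exact this.symm
  refine ⟨_, _, β, hα, fun y => ?_, hβ⟩
  obtain ⟨x, rfl⟩ := g.surjective y
  have hiff (i) : PrefixOf (β i) (g x) ↔ PrefixOf (List.ofFn (e i)) x := by
    constructor <;> intro h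
    · have := h.appendInf_dropInf
      rw [← hβ] at this
      rw [← g.injective this]
      exact prefixOf_appendInf _ _
    · rw [← h.appendInf_dropInf, hβ]
      exact prefixOf_appendInf _ _
  simpa only [hiff] using hα x

theorem LocallyExchangesPrefixes.continuous {f : Cantor n → Cantor n}
    (hf : LocallyExchangesPrefixes f) : Continuous f := by
  rw [continuous_iff_continuousAt]
  intro x U hU
  obtain ⟨V, hVU, hV, hxV⟩ := mem_nhds_iff.mp hU
  obtain ⟨m, hm⟩ := hV.exists_takeW hxV
  obtain ⟨k, β, hβ⟩ := hf x
  refine Filter.mem_map.mpr (Filter.mem_of_superset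
    ((isOpen_setOf_takeW_eq x (k + m)).mem_nhds rfl) fun y hy => hVU (hm _ ?_))
  simp only [Set.mem_ofPred_eq, takeW_add] at hy
  obtain ⟨h₁, h₂⟩ := List.append_inj hy (by simp)
  rw [← appendInf_takeW y k, ← appendInf_takeW x k, h₁, hβ, hβ]
  rw [takeW_eq_takeW_iff] at h₂ ⊢
  intro i hi
  by_cases h : i < β.length
  · rw [appendInf_of_lt h, appendInf_of_lt h]
  · simp only [appendInf, h, dite_false]
    exact h₂ _ (by omega)

/-- Exchange the prefixes `α` and `β`, fixing the words that start with neither. -/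
def swapPrefix (α β : List (Fin n)) (χ : Cantor n) : Cantor n :=
  if PrefixOf α χ then appendInf β (dropInf α.length χ)
  else if PrefixOf β χ then appendInf α (dropInf β.length χ) else χ

variable {α β : List (Fin n)}

theorem swapPrefix_appendInf_left (χ : Cantor n) :
    swapPrefix α β (appendInf α χ) = appendInf β χ := by
  simp [swapPrefix]

theorem swapPrefix_appendInf_right (h : ∀ χ, PrefixOf α χ → ¬ PrefixOf β χ) (χ : Cantor n) :
    swapPrefix α β (appendInf β χ) = appendInf α χ := by
  have : ¬ PrefixOf α (appendInf β χ) := fun hα => h _ hα (prefixOf_appendInf β χ)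
  simp [swapPrefix, this]

theorem swapPrefix_involutive (h : ∀ χ, PrefixOf α χ → ¬ PrefixOf β χ) :
    Function.Involutive (swapPrefix α β) := by
  intro χ
  by_cases hα : PrefixOf α χ
  · rw [← hα.appendInf_dropInf, swapPrefix_appendInf_left, swapPrefix_appendInf_right h]
  · by_cases hβ : PrefixOf β χ
    · rw [← hβ.appendInf_dropInf, swapPrefix_appendInf_right h, swapPrefix_appendInf_left]
    · simp [swapPrefix, hα, hβ]

theorem locallyExchangesPrefixes_swapPrefix (h : ∀ χ, PrefixOf α χ → ¬ PrefixOf β χ) :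
    LocallyExchangesPrefixes (swapPrefix α β) := by
  intro x
  by_cases hα : PrefixOf α x
  · exact ⟨α.length, β, fun χ => by
      rw [prefixOf_iff_takeW.mp hα, swapPrefix_appendInf_left]⟩
  by_cases hβ : PrefixOf β x
  · exact ⟨β.length, α, fun χ => by
      rw [prefixOf_iff_takeW.mp hβ, swapPrefix_appendInf_right h]⟩
  have key (k : ℕ) (w : List (Fin n)) (hw : w.length ≤ k) (hwx : ¬ PrefixOf w x)
      (χ : Cantor n) : ¬ PrefixOf w (appendInf (takeW x k) χ) := by
    intro hp
    have hx : PrefixOf (takeW x k) x := prefixOf_iff_takeW.mpr (by simp)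
    exact hwx (hx.of_isPrefix (hp.isPrefix (prefixOf_appendInf _ _) (by simpa using hw)))
  refine ⟨max α.length β.length, takeW x (max α.length β.length), fun χ => ?_⟩
  simp [swapPrefix, key _ _ (le_max_left _ _) hα, key _ _ (le_max_right _ _) hβ]

/-- `swapPrefix` for incomparable prefixes, as a homeomorphism. -/
def swapPrefixHomeo (h : ∀ χ, PrefixOf α χ → ¬ PrefixOf β χ) : Cantor n ≃ₜ Cantor n where
  toEquiv := (swapPrefix_involutive h).toPerm
  continuous_toFun := (locallyExchangesPrefixes_swapPrefix h).continuous
  continuous_invFun := (locallyExchangesPrefixes_swapPrefix h).continuous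

theorem swapPrefixHomeo_mem_Vn [Nonempty (Fin n)] (h : ∀ χ, PrefixOf α χ → ¬ PrefixOf β χ) :
    swapPrefixHomeo h ∈ Vn n :=
  mem_Vn_of_locallyExchangesPrefixes (locallyExchangesPrefixes_swapPrefix h)

end LocalPrefixExchange

namespace Transducer

variable {n : ℕ} {T : Transducer n}

theorem transStar_append (u v : List (Fin n)) (q : T.Q) :
    T.transStar (u ++ v) q = T.transStar v (T.transStar u q) := by
  induction u generalizing q with
  | nil => rfl
  | cons x u ih => exact ih _

theorem outStar_append (u v : List (Fin n)) (q : T.Q) :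
    T.outStar (u ++ v) q = T.outStar u q ++ T.outStar v (T.transStar u q) := by
  induction u generalizing q with
  | nil => rfl
  | cons x u ih => simp only [List.cons_append, outStar, transStar, ih, List.append_assoc]

theorem outStar_isPrefix {u v : List (Fin n)} (h : u <+: v) (q : T.Q) :
    T.outStar u q <+: T.outStar v q := by
  obtain ⟨t, rfl⟩ := h
  rw [outStar_append]
  exact List.prefix_append _ _

theorem Induces.prefixOf_outStar {q : T.Q} {f : Cantor n → Cantor n} (hf : T.Induces q f)
    (χ : Cantor n) (k : ℕ) : PrefixOf (T.outStar (takeW χ k) q) (f χ) := by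
  obtain ⟨l, hl, hp⟩ := hf χ (T.outStar (takeW χ k) q).length
  rcases le_total k l with h | h
  · exact hp.of_isPrefix (outStar_isPrefix (takeW_prefix_of_le h) q)
  · have h' := outStar_isPrefix (takeW_prefix_of_le (χ := χ) h) q
    rwa [← h'.eq_of_length_le hl]

theorem Induces.unique {q : T.Q} {f g : Cantor n → Cantor n} (hf : T.Induces q f)
    (hg : T.Induces q g) : f = g := by
  funext χ i
  obtain ⟨k, hk, hp⟩ := hf χ (i + 1)
  exact (hp i hk).symm.trans (hg.prefixOf_outStar χ k i hk)

theorem Induces.exists_residual {q : T.Q} {f : Cantor n → Cantor n} (hf : T.Induces q f)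
    (w : List (Fin n)) :
    ∃ F, T.Induces (T.transStar w q) F ∧
      ∀ z, f (appendInf w z) = appendInf (T.outStar w q) (F z) := by
  have hsplit (z : Cantor n) : appendInf (T.outStar w q)
      (dropInf (T.outStar w q).length (f (appendInf w z))) = f (appendInf w z) := by
    refine PrefixOf.appendInf_dropInf ?_
    simpa using hf.prefixOf_outStar (appendInf w z) w.length
  refine ⟨fun z => dropInf (T.outStar w q).length (f (appendInf w z)), fun z m => ?_,
    fun z => (hsplit z).symm⟩
  obtain ⟨k, hk, -⟩ := hf (appendInf w z) ((T.outStar w q).length + m)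
  have hlen := (outStar_isPrefix (T := T)
    (takeW_prefix_of_le (χ := appendInf w z) (Nat.le_add_left k w.length)) q).length_le
  have hp := hf.prefixOf_outStar (appendInf w z) (w.length + k)
  rw [takeW_appendInf_add, outStar_append] at hlen hp
  refine ⟨k, by rw [List.length_append] at hlen; omega, ?_⟩
  have := hp.appendInf_dropInf
  rw [appendInf_append] at this
  beta_reduce
  rw [← this, dropInf_appendInf]
  exact prefixOf_appendInf _ _

/-- Conjugation by a homeomorphism induced by a synchronizing transducer preserves `Vₙ`. -/
theorem Synchronizing.paperConj_mem_Vn [Nonempty (Fin n)] (hT : T.Synchronizing) {q : T.Q}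
    {h : Cantor n ≃ₜ Cantor n} (hh : T.Induces q h) {v : Cantor n ≃ₜ Cantor n}
    (hv : v ∈ Vn n) : paperConj h v ∈ Vn n := by
  refine mem_Vn_of_locallyExchangesPrefixes fun y => ?_
  obtain ⟨l, hl⟩ := hT
  obtain ⟨x, rfl⟩ := h.surjective y
  obtain ⟨k, β, hβ⟩ := locallyExchangesPrefixes_of_mem_Vn hv x
  set α := takeW x k
  set u := takeW (dropInf k x) l with hu
  have hx : takeW x (k + l) = α ++ u := takeW_add x k l
  obtain ⟨F, hF, hαF⟩ := hh.exists_residual (α ++ u)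
  obtain ⟨F', hF', hβF⟩ := hh.exists_residual (β ++ u)
  rw [transStar_append, hl u (by simp [hu]) _ q] at hF hF'
  obtain rfl := hF.unique hF'
  obtain ⟨m, hm⟩ := (h.isOpenMap _ (isOpen_setOf_takeW_eq x (k + l))).exists_takeW
    (Set.mem_image_of_mem h rfl)
  have hout : PrefixOf (T.outStar (α ++ u) q) (h x) := hx ▸ hh.prefixOf_outStar x (k + l)
  set a := T.outStar (α ++ u) q
  refine ⟨a.length + m, T.outStar (β ++ u) q ++ takeW (dropInf a.length (h x)) m,
    fun χ => ?_⟩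
  have hy : takeW (h x) (a.length + m) = a ++ takeW (dropInf a.length (h x)) m := by
    rw [takeW_add, prefixOf_iff_takeW.mp hout]
  obtain ⟨x', hx', hx'y⟩ := hm (appendInf (takeW (h x) (a.length + m)) χ) (by
    rw [Nat.add_comm, takeW_add, appendInf_append]
    conv_lhs => enter [2]; rw [← length_takeW (h x) m]
    rw [takeW_appendInf])
  simp only [Set.mem_ofPred_eq, hx] at hx'
  have hx'' : appendInf (α ++ u) (dropInf (k + l) x') = x' := by
    rw [← hx', appendInf_takeW]
  have hz : F (dropInf (k + l) x') = appendInf (takeW (dropInf a.length (h x)) m) χ := by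
    apply appendInf_injective a
    rw [← hαF, hx'', hx'y, hy, appendInf_append]
  change h (v (h.symm _)) = _
  rw [← hx'y, h.symm_apply_apply, ← hx'', appendInf_append, hβ, ← appendInf_append, hβF, hz,
    appendInf_append]

end Transducer

section Residuals

variable {n : ℕ}

/-- The first coordinate at which `F` is not constant (`0` if there is none). -/
def agreeLength (F : Cantor n → Cantor n) : ℕ := sInf {i | ∃ y z, F y i ≠ F z i}

/-- The longest common prefix of the values of `F`. -/
def commonPrefix [Nonempty (Fin n)] (F : Cantor n → Cantor n) : List (Fin n) :=
  takeW (F fun _ => Classical.arbitrary _) (agreeLength F)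

/-- `F` with the longest common prefix of its values removed. -/
def stripPrefix (F : Cantor n → Cantor n) (χ : Cantor n) : Cantor n :=
  dropInf (agreeLength F) (F χ)

theorem Function.Injective.exists_ne_coord [Nontrivial (Fin n)] {F : Cantor n → Cantor n}
    (hF : Function.Injective F) : {i | ∃ y z, F y i ≠ F z i}.Nonempty := by
  obtain ⟨y, z, hyz⟩ := exists_pair_ne (Cantor n)
  obtain ⟨i, hi⟩ := Function.ne_iff.mp (hF.ne hyz)
  exact ⟨i, y, z, hi⟩

theorem apply_eq_of_lt_agreeLength {F : Cantor n → Cantor n} {i : ℕ} (hi : i < agreeLength F)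
    (y z : Cantor n) : F y i = F z i := by
  by_contra h
  exact Nat.notMem_of_lt_sInf hi ⟨y, z, h⟩

theorem appendInf_commonPrefix [Nonempty (Fin n)] (F : Cantor n → Cantor n) (χ : Cantor n) :
    appendInf (commonPrefix F) (stripPrefix F χ) = F χ := by
  rw [commonPrefix, takeW_eq_takeW_iff.mpr fun i hi => apply_eq_of_lt_agreeLength hi _ χ]
  exact appendInf_takeW _ _

theorem le_agreeLength [Nontrivial (Fin n)] {F : Cantor n → Cantor n}
    (hF : Function.Injective F) {m : ℕ} (h : ∀ y z, takeW (F y) m = takeW (F z) m) :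
    m ≤ agreeLength F := by
  refine le_csInf hF.exists_ne_coord ?_
  rintro i ⟨y, z, hyz⟩
  by_contra hi
  exact hyz (takeW_eq_takeW_iff.mp (h y z) i (not_le.mp hi))

theorem agreeLength_appendInf [Nontrivial (Fin n)] {F G : Cantor n → Cantor n}
    (hF : Function.Injective F) {p : List (Fin n)} (h : ∀ z, F z = appendInf p (G z)) :
    agreeLength F = p.length + agreeLength G := by
  have hG : Function.Injective G := fun y z hyz => hF (by rw [h, h, hyz])
  apply le_antisymm
  · obtain ⟨y, z, hyz⟩ := Nat.sInf_mem hG.exists_ne_coord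
    refine Nat.sInf_le ⟨y, z, ?_⟩
    rw [h, h, Nat.add_comm, appendInf_add_length, appendInf_add_length]
    exact hyz
  · refine le_agreeLength hF fun y z => ?_
    rw [h, h, takeW_appendInf_add, takeW_appendInf_add,
      takeW_eq_takeW_iff.mpr fun i hi => apply_eq_of_lt_agreeLength hi y z]

theorem stripPrefix_appendInf [Nontrivial (Fin n)] {F G : Cantor n → Cantor n}
    (hF : Function.Injective F) {p : List (Fin n)} (h : ∀ z, F z = appendInf p (G z)) :
    stripPrefix F = stripPrefix G := by
  funext χ i
  simp only [stripPrefix, dropInf, h, agreeLength_appendInf hF h]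
  rw [← appendInf_add_length p (G χ)]
  congr 1
  omega

theorem commonPrefix_appendInf [Nontrivial (Fin n)] {F G : Cantor n → Cantor n}
    (hF : Function.Injective F) {p : List (Fin n)} (h : ∀ z, F z = appendInf p (G z)) :
    commonPrefix F = p ++ commonPrefix G := by
  rw [commonPrefix, agreeLength_appendInf hF h, h, takeW_appendInf_add, commonPrefix]

/-- The action of `g` below the finite word `w`. -/
def residualAt (g : Cantor n → Cantor n) (w : List (Fin n)) : Cantor n → Cantor n :=
  stripPrefix fun χ => g (appendInf w χ)

variable {g : Cantor n → Cantor n}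

theorem Function.Injective.comp_appendInf (hg : Function.Injective g) (w : List (Fin n)) :
    Function.Injective fun χ => g (appendInf w χ) :=
  hg.comp (appendInf_injective w)

theorem apply_appendInf_append [Nonempty (Fin n)] (g : Cantor n → Cantor n)
    (w u : List (Fin n)) (χ : Cantor n) :
    g (appendInf (w ++ u) χ) = appendInf (commonPrefix fun χ => g (appendInf w χ))
      (residualAt g w (appendInf u χ)) := by
  rw [appendInf_append]
  exact (appendInf_commonPrefix (fun χ => g (appendInf w χ)) (appendInf u χ)).symm

theorem residualAt_append [Nontrivial (Fin n)] (hg : Function.Injective g)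
    (w u : List (Fin n)) :
    residualAt g (w ++ u) = stripPrefix fun χ => residualAt g w (appendInf u χ) :=
  stripPrefix_appendInf (hg.comp_appendInf _) (apply_appendInf_append g w u)

theorem commonPrefix_append [Nontrivial (Fin n)] (hg : Function.Injective g)
    (w u : List (Fin n)) :
    (commonPrefix fun χ => g (appendInf (w ++ u) χ)) =
      (commonPrefix fun χ => g (appendInf w χ)) ++
        commonPrefix fun χ => residualAt g w (appendInf u χ) :=
  commonPrefix_appendInf (hg.comp_appendInf _) (apply_appendInf_append g w u)

/-- The transducer whose states are the local actions of the injective map `g`. -/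
def residualTransducer [Nontrivial (Fin n)] (hg : Function.Injective g) : Transducer n where
  Q := Set.range (residualAt g)
  tr x q := ⟨stripPrefix fun χ => q.1 (appendInf [x] χ), by
    obtain ⟨_, w, rfl⟩ := q
    exact ⟨w ++ [x], residualAt_append hg w [x]⟩⟩
  out x q := commonPrefix fun χ => q.1 (appendInf [x] χ)

/-- The state of the residual transducer given by the word `w`. -/
def residualState [Nontrivial (Fin n)] (hg : Function.Injective g) (w : List (Fin n)) :
    (residualTransducer hg).Q := ⟨residualAt g w, w, rfl⟩

theorem residualTransducer_tr [Nontrivial (Fin n)] (hg : Function.Injective g) (x : Fin n)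
    (w : List (Fin n)) :
    (residualTransducer hg).tr x (residualState hg w) =
      residualState hg (w ++ [x]) :=
  Subtype.ext (residualAt_append hg w [x]).symm

theorem residualTransducer_transStar [Nontrivial (Fin n)] (hg : Function.Injective g)
    (w u : List (Fin n)) :
    (residualTransducer hg).transStar u (residualState hg w) =
      residualState hg (w ++ u) := by
  induction u generalizing w with
  | nil => simp [Transducer.transStar]
  | cons x u ih =>
    rw [Transducer.transStar, residualTransducer_tr, ih]
    simp

theorem commonPrefix_append_outStar [Nontrivial (Fin n)] (hg : Function.Injective g)
    (w u : List (Fin n)) :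
    (commonPrefix fun χ => g (appendInf w χ)) ++
      (residualTransducer hg).outStar u (residualState hg w) =
        commonPrefix fun χ => g (appendInf (w ++ u) χ) := by
  induction u generalizing w with
  | nil => simp [Transducer.outStar]
  | cons x u ih =>
    rw [Transducer.outStar, residualTransducer_tr, ← List.append_assoc]
    have := ih (w ++ [x])
    rw [commonPrefix_append hg w [x], List.append_assoc w] at this
    exact this

theorem residualTransducer_induces [Nontrivial (Fin n)] (g : Cantor n ≃ₜ Cantor n) :
    (residualTransducer g.injective).Induces (residualState g.injective []) g := by
  have hnil : (commonPrefix fun χ => g (appendInf [] χ)) = [] := by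
    rw [← List.length_eq_zero_iff, commonPrefix, length_takeW, agreeLength, Nat.sInf_eq_zero]
    left
    obtain ⟨a, b, hab⟩ := exists_pair_ne (Fin n)
    exact ⟨g.symm fun _ => a, g.symm fun _ => b, by simpa using hab⟩
  intro χ m
  obtain ⟨k, hk⟩ := g.continuous.exists_takeW χ m
  have hout := commonPrefix_append_outStar g.injective [] (takeW χ k)
  rw [hnil, List.nil_append, List.nil_append] at hout
  refine ⟨k, ?_, ?_⟩ <;> rw [hout]
  · rw [commonPrefix, length_takeW]
    refine le_agreeLength (g.injective.comp_appendInf _) fun y z => ?_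
    have key (y : Cantor n) := hk (appendInf (takeW χ k) y)
      (by simpa using takeW_appendInf (takeW χ k) y)
    rw [key y, key z]
  · have := appendInf_commonPrefix (fun y => g (appendInf (takeW χ k) y)) (dropInf k χ)
    rw [appendInf_takeW] at this
    rw [← this]
    exact prefixOf_appendInf _ _

theorem residualTransducer_synchronizing [Nontrivial (Fin n)] (hg : Function.Injective g)
    {k : ℕ} (hk : ∀ w u : List (Fin n), k ≤ u.length →
      residualAt g (w ++ u) = residualAt g u) :
    (residualTransducer hg).Synchronizing := by
  refine ⟨k, ?_⟩
  rintro u hu ⟨_, w, rfl⟩ ⟨_, w', rfl⟩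
  change Transducer.transStar _ u (residualState hg w) =
    Transducer.transStar _ u (residualState hg w')
  rw [residualTransducer_transStar, residualTransducer_transStar]
  exact Subtype.ext ((hk w u hu.ge).trans (hk w' u hu.ge).symm)

theorem residualTransducer_finite [Nontrivial (Fin n)] (hg : Function.Injective g)
    {k : ℕ} (hk : ∀ w u : List (Fin n), k ≤ u.length →
      residualAt g (w ++ u) = residualAt g u) :
    Finite (residualTransducer hg).Q := by
  refine Set.Finite.subset ((List.finite_length_le (Fin n) k).image (residualAt g)) ?_
  rintro _ ⟨w, rfl⟩
  rcases le_total w.length k with h | h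
  · exact ⟨w, h, rfl⟩
  · refine ⟨w.drop (w.length - k), by simp; omega, ?_⟩
    conv_rhs => rw [← List.take_append_drop (w.length - k) w]
    exact (hk _ _ (by rw [List.length_drop]; omega)).symm

end Residuals

section Normalizer

variable {n : ℕ} [Nontrivial (Fin n)] {g : Cantor n ≃ₜ Cantor n}

theorem exists_residualAt_eq_of_incomparable (hg : ∀ v ∈ Vn n, paperConj g v ∈ Vn n)
    {α β : List (Fin n)} (h : ∀ χ, PrefixOf α χ → ¬ PrefixOf β χ) :
    ∃ k, ∀ u : List (Fin n), k ≤ u.length →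
      residualAt g (α ++ u) = residualAt g (β ++ u) := by
  refine exists_forall_length_ge fun χ => ?_
  obtain ⟨k, b, hb⟩ := locallyExchangesPrefixes_of_mem_Vn (hg _ (swapPrefixHomeo_mem_Vn h))
    (g (appendInf α χ))
  obtain ⟨j, hj⟩ := g.continuous.exists_takeW (appendInf α χ) k
  refine ⟨j, ?_⟩
  rintro _ ⟨t, rfl⟩
  set u := takeW χ j ++ t with hu
  have hα (z : Cantor n) : g (appendInf (α ++ u) z) = appendInf (takeW (g (appendInf α χ)) k)
      (dropInf k (g (appendInf (α ++ u) z))) := by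
    rw [← hj (appendInf (α ++ u) z), appendInf_takeW]
    have : takeW (appendInf (α ++ u) z) (α.length + j) =
        takeW (appendInf α χ) (α.length + j) := by
      rw [appendInf_append, takeW_appendInf_add, takeW_appendInf_add, hu, appendInf_append]
      conv_lhs => enter [2, 2]; rw [← length_takeW χ j]
      rw [takeW_appendInf]
    rw [takeW_eq_takeW_iff] at this ⊢
    exact fun i hi => this i (by omega)
  have hβ (z : Cantor n) : g (appendInf (β ++ u) z) =
      appendInf b (dropInf k (g (appendInf (α ++ u) z))) := by
    rw [← hb, ← hα]
    change _ = g (swapPrefix α β (g.symm _))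
    rw [g.symm_apply_apply, appendInf_append α, swapPrefix_appendInf_left, appendInf_append]
  exact (stripPrefix_appendInf (g.injective.comp_appendInf _) hα).trans
    (stripPrefix_appendInf (g.injective.comp_appendInf _) hβ).symm

theorem exists_residualAt_cons_eq (hg : ∀ v ∈ Vn n, paperConj g v ∈ Vn n) (x a : Fin n) :
    ∃ k, ∀ u : List (Fin n), k ≤ u.length →
      residualAt g (x :: a :: u) = residualAt g (a :: u) := by
  by_cases hxa : x = a
  · subst hxa
    obtain ⟨b, hb⟩ := exists_ne x
    obtain ⟨k, hk⟩ := exists_residualAt_eq_of_incomparable hg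
      (incomparable_of_ne hb.symm [x] [x])
    obtain ⟨l, hl⟩ := exists_residualAt_eq_of_incomparable hg (incomparable_of_ne hb [x] [])
    exact ⟨max k l, fun u hu => (hk u (le_of_max_le_left hu)).trans
      (hl u (le_of_max_le_right hu))⟩
  · exact exists_residualAt_eq_of_incomparable hg (incomparable_of_ne hxa [a] [])

theorem exists_residualAt_append_eq (hg : ∀ v ∈ Vn n, paperConj g v ∈ Vn n) :
    ∃ k, ∀ w u : List (Fin n), k ≤ u.length → residualAt g (w ++ u) = residualAt g u := by
  choose k hk using exists_residualAt_cons_eq hg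
  let K := Finset.univ.sup fun p : Fin n × Fin n => k p.1 p.2
  refine ⟨K + 1, fun w u hu => ?_⟩
  induction w with
  | nil => rfl
  | cons x w ih =>
    rw [← ih, List.cons_append]
    obtain ⟨a, t, ht⟩ : ∃ a t, w ++ u = a :: t :=
      List.exists_cons_of_length_pos (by rw [List.length_append]; omega)
    have hlen := congrArg List.length ht
    rw [List.length_append, List.length_cons] at hlen
    have hK : k x a ≤ K :=
      Finset.le_sup (f := fun p : Fin n × Fin n => k p.1 p.2) (Finset.mem_univ (x, a))
    rw [ht]
    exact hk x a t (by omega)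

/-- A homeomorphism conjugating `Vₙ` into itself is induced by a finite synchronizing
transducer. -/
theorem exists_synchronizing_of_paperConj_mem_Vn (hg : ∀ v ∈ Vn n, paperConj g v ∈ Vn n) :
    ∃ (S : Transducer n) (_ : Finite S.Q) (s0 : S.Q), S.Induces s0 g ∧ S.Synchronizing := by
  obtain ⟨k, hk⟩ := exists_residualAt_append_eq hg
  exact ⟨residualTransducer g.injective, residualTransducer_finite g.injective hk, _,
    residualTransducer_induces g, residualTransducer_synchronizing g.injective hk⟩

end Normalizer

theorem paperConj_mul {n : ℕ} (a b v : Cantor n ≃ₜ Cantor n) :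
    paperConj (a * b) v = paperConj a (paperConj b v) := rfl

theorem paperConj_symm_paperConj {n : ℕ} (a v : Cantor n ≃ₜ Cantor n) :
    paperConj a.symm (paperConj a v) = v := by
  ext x
  simp [paperConj]

/-- For an initial one-way synchronizing transducer `T_{q0}`
representing a homeomorphism of Cantor space, the conjugates of `Vₙ` by the integer
powers of `T_{q0}` form a strictly increasing chain:
`⋯ ⊊ Vₙ^{T²} ⊊ Vₙ^{T} ⊊ Vₙ ⊊ Vₙ^{T⁻¹} ⊊ Vₙ^{T⁻²} ⊊ ⋯`,
i.e. `Vₙ^{T^{m+1}} ⊊ Vₙ^{T^{m}}` for every integer `m`, where `Vₙ^h = h⁻¹ Vₙ h`. -/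
theorem strict_chain_of_conjugates_of_Vn
    {n : ℕ} (hn : 2 ≤ n) (T : Transducer n) [Finite T.Q] (q0 : T.Q)
    (h : Cantor n ≃ₜ Cantor n) (hOne : T.OneWaySync q0 h) :
    ∀ m : ℤ, paperConj (h ^ (m + 1)) '' Vn n ⊂ paperConj (h ^ m) '' Vn n := by
  have : Nontrivial (Fin n) := Fin.nontrivial_iff_two_le.mpr hn
  obtain ⟨hind, hsync, hinv⟩ := hOne
  have key : paperConj h '' Vn n ⊂ Vn n := by
    refine ssubset_of_subset_of_ne ?_ fun heq => hinv ?_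
    · rintro _ ⟨v, hv, rfl⟩
      exact hsync.paperConj_mem_Vn hind hv
    · refine exists_synchronizing_of_paperConj_mem_Vn fun v hv => ?_
      rw [← heq] at hv
      obtain ⟨v, hv, rfl⟩ := hv
      rwa [paperConj_symm_paperConj]
  intro m
  have hcomp : paperConj (h ^ (m + 1)) = paperConj (h ^ m) ∘ paperConj h := by
    funext v
    rw [zpow_add_one, paperConj_mul, Function.comp_apply]
  rw [hcomp, Set.image_comp]
  have hinj : Function.Injective (paperConj (h ^ m)) :=
    Function.LeftInverse.injective (paperConj_symm_paperConj (h ^ m))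
  exact hinj.image_strictMono key
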